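/- arXiv:2203.05905 — 2 statements merged into one kernel-verified Lean document; each statement's English description precedes it below -/
import Mathlib

section
/- Assume (H1), (H2), (H3), and (H4), and that s ↦ f(s,z_s) is Lebesgue integrable on [0,τ] for every bounded z : [−r,τ] → ℝⁿ. If z₁, z₂ : [−r,τ] → ℝⁿ both satisfy sup_{t∈[−r,τ]} ‖zⱼ(t) − φ̃(t)‖ ≤ ρ (j = 1,2) and both satisfy the integral equations (z(t) = U(t,0)·[φ(0) − g(z_{θ₁},…,z_{θ_q})(0)] + ∫₀ᵗ U(t,s)·f(s,z_s) ds for t ∈ (0,t₁]; z(t) = U(t,sᵢ)·Gᵢ(sᵢ,z(sᵢ)) + ∫_{sᵢ}ᵗ U(t,s)·f(s,z_s) ds for t ∈ (sᵢ,t_{i+1}], i = 1,…,N; z(t) = Gᵢ(t,z(t)) for t ∈ (tᵢ,sᵢ]; z(t) = φ(t) − g(z_{θ₁},…,z_{θ_q})(t) for t ∈ [−r,0]), then z₁ = z₂ on [−r,τ]. -/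
open Matrix MeasureTheory Set Filter

/-- supremum of the norm of `w` over the interval `[a, b]`. -/
noncomputable def supOn {E : Type*} [NormedAddCommGroup E]
    (a b : ℝ) (w : ℝ → E) : ℝ :=
  ⨆ u : Set.Icc a b, ‖w u.1‖

/-- `w` is bounded (in norm) on the interval `[a, b]`. -/
def BddOn {E : Type*} [NormedAddCommGroup E] (a b : ℝ) (w : ℝ → E) : Prop :=
  ∃ C : ℝ, ∀ u ∈ Set.Icc a b, ‖w u‖ ≤ C

theorem BddOn.norm_le_supOn {E : Type*} [NormedAddCommGroup E] {a b : ℝ} {w : ℝ → E}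
    (hw : BddOn a b w) {u : ℝ} (hu : u ∈ Set.Icc a b) : ‖w u‖ ≤ supOn a b w := by
  obtain ⟨C, hC⟩ := hw
  exact le_ciSup (f := fun u : Set.Icc a b => ‖w u.1‖)
    ⟨C, by rintro _ ⟨v, rfl⟩; exact hC v.1 v.2⟩ ⟨u, hu⟩

theorem supOn_le {E : Type*} [NormedAddCommGroup E] {a b C : ℝ} {w : ℝ → E}
    (hC : 0 ≤ C) (h : ∀ u ∈ Set.Icc a b, ‖w u‖ ≤ C) : supOn a b w ≤ C :=
  Real.iSup_le (fun u => h u.1 u.2) hC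

theorem supOn_nonneg {E : Type*} [NormedAddCommGroup E] (a b : ℝ) (w : ℝ → E) :
    0 ≤ supOn a b w :=
  Real.iSup_nonneg fun _ => norm_nonneg _

/-- A bounded function whose bounds all improve by a factor `c < 1` vanishes. -/
theorem BddOn.eq_zero_of_contracting {E : Type*} [NormedAddCommGroup E] {a b c : ℝ} {w : ℝ → E}
    (hw : BddOn a b w) (hc0 : 0 ≤ c) (hc : c < 1)
    (h : ∀ D, 0 ≤ D → (∀ u ∈ Set.Icc a b, ‖w u‖ ≤ D) → ∀ u ∈ Set.Icc a b, ‖w u‖ ≤ c * D) :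
    ∀ u ∈ Set.Icc a b, w u = 0 := by
  have h0 := supOn_nonneg a b w
  have h1 : supOn a b w ≤ c * supOn a b w :=
    supOn_le (mul_nonneg hc0 h0) (h _ h0 fun u hu => hw.norm_le_supOn hu)
  intro u hu
  have h2 := hw.norm_le_supOn hu
  have h3 : supOn a b w ≤ 0 := by nlinarith
  exact norm_le_zero_iff.mp (h2.trans h3)

/-- The intervals `(tᵢ, sᵢ]` and `(sᵢ, tᵢ₊₁]` cover everything between `t₁` and `t_{N+1}`. -/
theorem exists_mem_Ioc_of_le (tt ss : ℕ → ℝ) (N : ℕ) {u : ℝ} (hu : u ≤ tt (N + 1)) :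
    u ≤ tt 1 ∨ ∃ i ∈ Finset.Icc 1 N,
      u ∈ Set.Ioc (tt i) (ss i) ∨ u ∈ Set.Ioc (ss i) (tt (i + 1)) := by
  induction N with
  | zero => exact Or.inl hu
  | succ k ih =>
    rcases le_or_gt u (tt (k + 1)) with h | h
    · rcases ih h with h1 | ⟨i, hi, h1⟩
      · exact Or.inl h1
      · refine Or.inr ⟨i, ?_, h1⟩
        simp only [Finset.mem_Icc] at hi ⊢
        omega
    · refine Or.inr ⟨k + 1, by simp, ?_⟩
      rcases le_or_gt u (ss (k + 1)) with h1 | h1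
      · exact Or.inl ⟨h, h1⟩
      · exact Or.inr ⟨h1, hu⟩

theorem le_of_forall_le_succ {a : ℕ → ℝ} {N : ℕ}
    (h : ∀ i ∈ Finset.Icc 1 N, a i ≤ a (i + 1)) {j k : ℕ} (hj : 1 ≤ j) (hjk : j ≤ k)
    (hk : k ≤ N + 1) : a j ≤ a k := by
  induction k, hjk using Nat.le_induction with
  | base => exact le_rfl
  | succ k hjk ih =>
    exact (ih (by omega)).trans (h k (Finset.mem_Icc.mpr ⟨by omega, by omega⟩))

theorem Continuous.matrix_inv_of_isUnit {n : ℕ} {Φ : ℝ → Matrix (Fin n) (Fin n) ℝ}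
    (hΦ : Continuous Φ) (hinv : ∀ t, IsUnit (Φ t)) : Continuous fun t => (Φ t)⁻¹ := by
  have hdet : ∀ t, (Φ t).det ≠ 0 := fun t =>
    ((Matrix.isUnit_iff_isUnit_det _).mp (hinv t)).ne_zero
  have : (fun t => (Φ t)⁻¹) = fun t => ((Φ t).det)⁻¹ • (Φ t).adjugate := by
    funext t
    rw [Matrix.inv_def, Ring.inverse_eq_inv']
  rw [this]
  exact (hΦ.matrix_det.inv₀ hdet).smul hΦ.matrix_adjugate

theorem IntervalIntegrable.mulVec_of_continuous {n : ℕ} {a b : ℝ} {F : ℝ → Fin n → ℝ}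
    {W : ℝ → Matrix (Fin n) (Fin n) ℝ} (hF : IntervalIntegrable F volume a b)
    (hW : Continuous W) : IntervalIntegrable (fun v => W v *ᵥ F v) volume a b := by
  have hFj : ∀ j, IntervalIntegrable (fun v => F v j) volume a b := fun j =>
    ⟨hF.1.eval j, hF.2.eval j⟩
  have key : ∀ k, IntervalIntegrable (fun v => (W v *ᵥ F v) k) volume a b := by
    intro k
    have hsum : (fun v => (W v *ᵥ F v) k) = ∑ j, fun v => W v k j * F v j := by
      funext v
      simp [Matrix.mulVec, dotProduct]
    rw [hsum]
    exact IntervalIntegrable.sum Finset.univ fun j _ =>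
      (hFj j).continuousOn_mul (hW.matrix_elem k j).continuousOn
  exact ⟨Integrable.of_eval fun k => (key k).1, Integrable.of_eval fun k => (key k).2⟩

/-- If `‖F₁ - F₂‖ ≤ C` and the kernel `W` has norm at most `M`, the integrals of `W F₁` and
`W F₂` over `[a, u]` differ by at most `M C (u - a)`. -/
theorem norm_integral_mulVec_sub_le {n : ℕ} {a u M C : ℝ} (hau : a ≤ u) (hM : 0 ≤ M)
    {F₁ F₂ : ℝ → Fin n → ℝ} {W : ℝ → Matrix (Fin n) (Fin n) ℝ} (hW : Continuous W)
    (hF₁ : IntervalIntegrable F₁ volume a u) (hF₂ : IntervalIntegrable F₂ volume a u)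
    (hWM : ∀ v ∈ Set.Icc a u, ∀ x, ‖W v *ᵥ x‖ ≤ M * ‖x‖)
    (hFC : ∀ v ∈ Set.Icc a u, ‖F₁ v - F₂ v‖ ≤ C) :
    ‖(∫ v in a..u, W v *ᵥ F₁ v) - ∫ v in a..u, W v *ᵥ F₂ v‖ ≤ M * C * (u - a) := by
  rw [← intervalIntegral.integral_sub (hF₁.mulVec_of_continuous hW)
    (hF₂.mulVec_of_continuous hW), ← abs_of_nonneg (sub_nonneg.mpr hau)]
  refine intervalIntegral.norm_integral_le_of_norm_le_const fun v hv => ?_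
  rw [Set.uIoc_of_le hau] at hv
  have hv' := Set.Ioc_subset_Icc_self hv
  rw [← Matrix.mulVec_sub]
  exact (hWM v hv' _).trans (mul_le_mul_of_nonneg_left (hFC v hv') hM)

/-- Affine variation-of-constants formulas with bounded propagator depend in a Lipschitz way on
the initial vector and the inhomogeneity. -/
theorem norm_sub_le_of_eq_mulVec_add_integral {n : ℕ} {a u M C τ : ℝ} (ha : 0 ≤ a) (hau : a ≤ u)
    (huτ : u ≤ τ) (hM : 0 ≤ M) (hC : 0 ≤ C) {U : ℝ → ℝ → Matrix (Fin n) (Fin n) ℝ}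
    (hU : ∀ t, Continuous (U t))
    (hUbd : ∀ t s : ℝ, 0 ≤ s → s ≤ t → t ≤ τ → ∀ x : Fin n → ℝ, ‖U t s *ᵥ x‖ ≤ M * ‖x‖)
    {F₁ F₂ : ℝ → Fin n → ℝ}
    (hF₁ : IntervalIntegrable F₁ volume 0 τ) (hF₂ : IntervalIntegrable F₂ volume 0 τ)
    (hFC : ∀ v ∈ Set.Icc (0 : ℝ) τ, ‖F₁ v - F₂ v‖ ≤ C) {x₁ x₂ y₁ y₂ : Fin n → ℝ}
    (h₁ : y₁ = U u a *ᵥ x₁ + ∫ v in a..u, U u v *ᵥ F₁ v)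
    (h₂ : y₂ = U u a *ᵥ x₂ + ∫ v in a..u, U u v *ᵥ F₂ v) :
    ‖y₁ - y₂‖ ≤ M * ‖x₁ - x₂‖ + M * τ * C := by
  have hsub : Set.uIcc a u ⊆ Set.uIcc 0 τ := by
    rw [Set.uIcc_of_le hau, Set.uIcc_of_le (ha.trans (hau.trans huτ))]
    exact Set.Icc_subset_Icc ha huτ
  have hint := norm_integral_mulVec_sub_le hau hM (hU u) (hF₁.mono_set hsub)
    (hF₂.mono_set hsub) (fun v hv => hUbd u v (ha.trans hv.1) hv.2 huτ)
    fun v hv => hFC v ⟨ha.trans hv.1, hv.2.trans huτ⟩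
  have hx := hUbd u a ha hau huτ (x₁ - x₂)
  rw [Matrix.mulVec_sub] at hx
  have hτ : M * C * (u - a) ≤ M * τ * C := by
    have := mul_le_mul_of_nonneg_left (show u - a ≤ τ by linarith) (mul_nonneg hM hC)
    linarith
  rw [h₁, h₂, add_sub_add_comm]
  exact (norm_add_le _ _).trans (by linarith)

/-- **Uniqueness.** Under (H1)–(H4), two solutions of the integral equations
lying in the ball `D_ρ` around `φ̃` coincide on `[−r,τ]`. -/
theorem uniqueness_of_solutions
    (n N q : ℕ) (hn : 1 ≤ n)
    (r τ : ℝ) (hr : 0 < r) (hτ : 0 < τ)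
    (tt ss : ℕ → ℝ) (htt0 : tt 0 = 0) (hss0 : ss 0 = 0) (htt1 : 0 < tt 1)
    (hts : ∀ i ∈ Finset.Icc 1 N, tt i ≤ ss i ∧ ss i < tt (i + 1))
    (httN : tt (N + 1) = τ)
    (θ : ℕ → ℝ) (hθ : ∀ j ∈ Finset.Icc 1 q, 0 < θ j ∧ θ j < τ)
    (hθmono : ∀ j ∈ Finset.Icc 1 (q - 1), θ j < θ (j + 1))
    (A : ℝ → Matrix (Fin n) (Fin n) ℝ) (hA : Continuous A)
    (Φ : ℝ → Matrix (Fin n) (Fin n) ℝ)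
    (hΦderiv : ∀ t : ℝ, ∀ i j : Fin n,
      HasDerivAt (fun u => Φ u i j) ((A t * Φ t) i j) t)
    (hΦ0 : Φ 0 = 1) (hΦinv : ∀ t, IsUnit (Φ t))
    (U : ℝ → ℝ → Matrix (Fin n) (Fin n) ℝ)
    (hU : ∀ t s : ℝ, U t s = Φ t * (Φ s)⁻¹)
    (M : ℝ) (hM : 1 ≤ M)
    (hUbd : ∀ t s : ℝ, 0 ≤ s → s ≤ t → t ≤ τ →
      ∀ x : Fin n → ℝ, ‖U t s *ᵥ x‖ ≤ M * ‖x‖)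
    -- (H1)
    (Nq L : ℝ) (hNq : 0 < Nq) (hL : 0 < L) (hNqL : L + Nq * (q : ℝ) < 1 / 2)
    (g : (Fin q → ℝ → (Fin n → ℝ)) → ℝ → (Fin n → ℝ))
    (hg0 : g (fun _ _ => 0) = fun _ => 0)
    (hglip : ∀ y z : Fin q → ℝ → (Fin n → ℝ), ∀ u ∈ Set.Icc (-r) (0 : ℝ),
      ‖g y u - g z u‖ ≤ Nq * ∑ j : Fin q, ‖y j u - z j u‖)
    (G : ℕ → ℝ → (Fin n → ℝ) → (Fin n → ℝ))
    (hG0 : ∀ i ∈ Finset.Icc 1 N, ∀ u : ℝ, G i u 0 = 0)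
    (hGlip : ∀ i ∈ Finset.Icc 1 N, ∀ (u : ℝ) (x y : Fin n → ℝ),
      ‖G i u x - G i u y‖ ≤ L * ‖x - y‖)
    -- (H2)
    (f : ℝ → (ℝ → (Fin n → ℝ)) → (Fin n → ℝ))
    (K : ℝ → ℝ → ℝ) (Ψ : ℝ → ℝ)
    (hKcont : Continuous fun p : ℝ × ℝ => K p.1 p.2)
    (hKmono : ∀ a a' b b' : ℝ, a ≤ a' → b ≤ b' → K a b ≤ K a' b')
    (hKnonneg : ∀ a b : ℝ, 0 ≤ K a b)
    (hΨcont : Continuous Ψ) (hΨmono : Monotone Ψ) (hΨnonneg : ∀ a : ℝ, 0 ≤ Ψ a)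
    (hflip : ∀ u ∈ Set.Icc (0 : ℝ) τ, ∀ φ₁ φ₂ : ℝ → (Fin n → ℝ),
      BddOn (-r) 0 φ₁ → BddOn (-r) 0 φ₂ →
      ‖f u φ₁ - f u φ₂‖ ≤ K (supOn (-r) 0 φ₁) (supOn (-r) 0 φ₂) * supOn (-r) 0 (φ₁ - φ₂))
    (hfbd : ∀ u ∈ Set.Icc (0 : ℝ) τ, ∀ φ' : ℝ → (Fin n → ℝ),
      BddOn (-r) 0 φ' → ‖f u φ'‖ ≤ Ψ (supOn (-r) 0 φ'))
    -- integrability of the superposition for every bounded input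
    (hfint : ∀ w : ℝ → (Fin n → ℝ), BddOn (-r) τ w →
      IntervalIntegrable (fun u => f u (fun v => w (u + v))) volume 0 τ)
    -- data: history φ and the vectors α, β of φ̃
    (φ : ℝ → (Fin n → ℝ)) (hφ : BddOn (-r) 0 φ)
    (α β : Fin n → ℝ) (ρ : ℝ) (hρ : 0 < ρ)
    -- φ̃, characterized by its defining piecewise equations
    (φt : ℝ → (Fin n → ℝ))
    (hφt1 : ∀ u ∈ Set.Ioc (0 : ℝ) (tt 1), φt u = U u 0 *ᵥ φ 0)
    (hφt2 : ∀ i ∈ Finset.Icc 1 N, ∀ u ∈ Set.Ioc (ss i) (tt (i + 1)), φt u = α)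
    (hφt3 : ∀ i ∈ Finset.Icc 1 N, ∀ u ∈ Set.Ioc (tt i) (ss i), φt u = β)
    (hφt4 : ∀ u ∈ Set.Icc (-r) (0 : ℝ), φt u = φ u)
    -- (H3)
    (h3i : M * Nq * (q : ℝ) * (supOn (-r) τ φt + ρ)
        + M * τ * Ψ (supOn (-r) τ φt + ρ) ≤ ρ)
    (h3ii : M * L * (supOn (-r) τ φt + ρ) + ‖α‖
        + M * τ * Ψ (supOn (-r) τ φt + ρ) ≤ ρ)
    (h3iii : L * (supOn (-r) τ φt + ρ) + ‖β‖ ≤ ρ)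
    -- (H4)
    (h4i : M * Nq * (q : ℝ)
        + M * τ * K (supOn (-r) τ φt + ρ) (supOn (-r) τ φt + ρ) < 1)
    (h4ii : M * L
        + M * τ * K (supOn (-r) τ φt + ρ) (supOn (-r) τ φt + ρ) < 1)
    -- two solutions in D_ρ
    (z₁ z₂ : ℝ → (Fin n → ℝ))
    (hz₁ρ : ∀ u ∈ Set.Icc (-r) τ, ‖z₁ u - φt u‖ ≤ ρ)
    (hz₂ρ : ∀ u ∈ Set.Icc (-r) τ, ‖z₂ u - φt u‖ ≤ ρ)
    (hz₁1 : ∀ u ∈ Set.Ioc (0 : ℝ) (tt 1), z₁ u =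
      U u 0 *ᵥ (φ 0 - g (fun j w => z₁ (θ (j.1 + 1) + w)) 0)
        + ∫ v in (0 : ℝ)..u, U u v *ᵥ f v (fun w => z₁ (v + w)))
    (hz₁2 : ∀ i ∈ Finset.Icc 1 N, ∀ u ∈ Set.Ioc (ss i) (tt (i + 1)), z₁ u =
      U u (ss i) *ᵥ G i (ss i) (z₁ (ss i))
        + ∫ v in (ss i)..u, U u v *ᵥ f v (fun w => z₁ (v + w)))
    (hz₁3 : ∀ i ∈ Finset.Icc 1 N, ∀ u ∈ Set.Ioc (tt i) (ss i), z₁ u = G i u (z₁ u))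
    (hz₁4 : ∀ u ∈ Set.Icc (-r) (0 : ℝ),
      z₁ u = φ u - g (fun j w => z₁ (θ (j.1 + 1) + w)) u)
    (hz₂1 : ∀ u ∈ Set.Ioc (0 : ℝ) (tt 1), z₂ u =
      U u 0 *ᵥ (φ 0 - g (fun j w => z₂ (θ (j.1 + 1) + w)) 0)
        + ∫ v in (0 : ℝ)..u, U u v *ᵥ f v (fun w => z₂ (v + w)))
    (hz₂2 : ∀ i ∈ Finset.Icc 1 N, ∀ u ∈ Set.Ioc (ss i) (tt (i + 1)), z₂ u =
      U u (ss i) *ᵥ G i (ss i) (z₂ (ss i))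
        + ∫ v in (ss i)..u, U u v *ᵥ f v (fun w => z₂ (v + w)))
    (hz₂3 : ∀ i ∈ Finset.Icc 1 N, ∀ u ∈ Set.Ioc (tt i) (ss i), z₂ u = G i u (z₂ u))
    (hz₂4 : ∀ u ∈ Set.Icc (-r) (0 : ℝ),
      z₂ u = φ u - g (fun j w => z₂ (θ (j.1 + 1) + w)) u)
 :
    ∀ u ∈ Set.Icc (-r) τ, z₁ u = z₂ u := by
  have hM0 : 0 ≤ M := zero_le_one.trans hM
  have htt_succ : ∀ i ∈ Finset.Icc 1 N, tt i ≤ tt (i + 1) := fun i hi =>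
    (hts i hi).1.trans (hts i hi).2.le
  have htt1τ : tt 1 ≤ τ := httN ▸ le_of_forall_le_succ htt_succ le_rfl (by omega) le_rfl
  have htt_nonneg : ∀ i ∈ Finset.Icc 1 N, 0 ≤ tt i := by
    intro i hi
    rw [Finset.mem_Icc] at hi
    exact htt1.le.trans (le_of_forall_le_succ htt_succ le_rfl hi.1 (by omega))
  have htt_le : ∀ i ∈ Finset.Icc 1 N, tt (i + 1) ≤ τ := by
    intro i hi
    rw [Finset.mem_Icc] at hi
    exact httN ▸ le_of_forall_le_succ htt_succ (by omega) (by omega) le_rfl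
  have hcover : ∀ u ∈ Set.Icc (-r) τ, u ∈ Set.Icc (-r) 0 ∨ u ∈ Set.Ioc 0 (tt 1) ∨
      ∃ i ∈ Finset.Icc 1 N, u ∈ Set.Ioc (tt i) (ss i) ∨ u ∈ Set.Ioc (ss i) (tt (i + 1)) := by
    intro u hu
    rcases le_or_gt u 0 with h | h
    · exact Or.inl ⟨hu.1, h⟩
    · rcases exists_mem_Ioc_of_le tt ss N (httN.symm ▸ hu.2) with h1 | h1
      · exact Or.inr (Or.inl ⟨h, h1⟩)
      · exact Or.inr (Or.inr h1)
  have hΦcont : Continuous Φ := continuous_matrix fun i j =>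
    continuous_iff_continuousAt.mpr fun t => (hΦderiv t i j).continuousAt
  have hUcont : ∀ t, Continuous (U t) := by
    intro t
    rw [show U t = fun s => Φ t * (Φ s)⁻¹ from funext (hU t)]
    exact continuous_const.mul (hΦcont.matrix_inv_of_isUnit hΦinv)
  have hφtbdd : BddOn (-r) τ φt := by
    obtain ⟨C, hC⟩ := hφ
    have hC0 : 0 ≤ C := (norm_nonneg _).trans (hC 0 ⟨by linarith, le_rfl⟩)
    have hMφ : 0 ≤ M * ‖φ 0‖ := by positivity
    have hα := norm_nonneg α
    have hβ := norm_nonneg β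
    refine ⟨C + M * ‖φ 0‖ + ‖α‖ + ‖β‖, fun u hu => ?_⟩
    rcases hcover u hu with h | h | ⟨i, hi, h | h⟩
    · rw [hφt4 u h]
      linarith [hC u h]
    · rw [hφt1 u h]
      linarith [hUbd u 0 le_rfl h.1.le hu.2 (φ 0)]
    · rw [hφt3 i hi u h]
      linarith
    · rw [hφt2 i hi u h]
      linarith
  set R := supOn (-r) τ φt + ρ
  have hR0 : 0 ≤ R := add_nonneg (supOn_nonneg _ _ _) hρ.le
  have hball : ∀ z : ℝ → Fin n → ℝ, (∀ u ∈ Set.Icc (-r) τ, ‖z u - φt u‖ ≤ ρ) →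
      ∀ u ∈ Set.Icc (-r) τ, ‖z u‖ ≤ R := by
    intro z hz u hu
    linarith [hz u hu, hφtbdd.norm_le_supOn hu, norm_sub_norm_le (z u) (φt u)]
  have hz₁R := hball z₁ hz₁ρ
  have hz₂R := hball z₂ hz₂ρ
  have hmem : ∀ v ∈ Set.Icc (0 : ℝ) τ, ∀ w ∈ Set.Icc (-r) (0 : ℝ), v + w ∈ Set.Icc (-r) τ :=
    fun v hv w hw => ⟨by linarith [hv.1, hw.1], by linarith [hv.2, hw.2]⟩
  set κ := K R R
  have hκ0 : 0 ≤ κ := hKnonneg R R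
  have hfdiff : ∀ D, 0 ≤ D → (∀ u ∈ Set.Icc (-r) τ, ‖(z₁ - z₂) u‖ ≤ D) →
      ∀ v ∈ Set.Icc (0 : ℝ) τ,
        ‖f v (fun w => z₁ (v + w)) - f v (fun w => z₂ (v + w))‖ ≤ κ * D := by
    intro D hD0 hD v hv
    have hb₁ : ∀ w ∈ Set.Icc (-r) (0 : ℝ), ‖z₁ (v + w)‖ ≤ R := fun w hw =>
      hz₁R _ (hmem v hv w hw)
    have hb₂ : ∀ w ∈ Set.Icc (-r) (0 : ℝ), ‖z₂ (v + w)‖ ≤ R := fun w hw =>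
      hz₂R _ (hmem v hv w hw)
    refine (hflip v hv _ _ ⟨R, hb₁⟩ ⟨R, hb₂⟩).trans ?_
    exact mul_le_mul (hKmono _ _ _ _ (supOn_le hR0 hb₁) (supOn_le hR0 hb₂))
      (supOn_le hD0 fun w hw => hD _ (hmem v hv w hw)) (supOn_nonneg _ _ _) hκ0
  have hgdiff : ∀ D, (∀ u ∈ Set.Icc (-r) τ, ‖(z₁ - z₂) u‖ ≤ D) →
      ∀ u ∈ Set.Icc (-r) (0 : ℝ), ‖(φ u - g (fun j w => z₁ (θ (j.1 + 1) + w)) u)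
        - (φ u - g (fun j w => z₂ (θ (j.1 + 1) + w)) u)‖ ≤ Nq * q * D := by
    intro D hD u hu
    rw [sub_sub_sub_cancel_left, norm_sub_rev]
    refine (hglip _ _ u hu).trans ?_
    rw [mul_assoc]
    refine mul_le_mul_of_nonneg_left ?_ hNq.le
    refine (Finset.sum_le_card_nsmul Finset.univ _ D fun j _ => ?_).trans (by simp)
    have hj := hθ (j.1 + 1) (Finset.mem_Icc.mpr ⟨by omega, by have := j.2; omega⟩)
    exact hD _ (hmem _ ⟨hj.1.le, hj.2.le⟩ u hu)
  have hint₁ := hfint z₁ ⟨R, hz₁R⟩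
  have hint₂ := hfint z₂ ⟨R, hz₂R⟩
  have hNqq : 0 ≤ Nq * (q : ℝ) := by positivity
  have hMτκ : 0 ≤ M * τ * κ := by positivity
  have hbdd : BddOn (-r) τ (z₁ - z₂) := ⟨R + R, fun u hu =>
    (norm_sub_le _ _).trans (add_le_add (hz₁R u hu) (hz₂R u hu))⟩
  set c := max (M * Nq * (q : ℝ) + M * τ * κ) (M * L + M * τ * κ)
  have hc₁ : M * Nq * (q : ℝ) + M * τ * κ ≤ c := le_max_left _ _
  have hc₂ : M * L + M * τ * κ ≤ c := le_max_right _ _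
  have hc0 : 0 ≤ c := le_trans (by positivity) hc₁
  have hcontr : ∀ D, 0 ≤ D → (∀ u ∈ Set.Icc (-r) τ, ‖(z₁ - z₂) u‖ ≤ D) →
      ∀ u ∈ Set.Icc (-r) τ, ‖(z₁ - z₂) u‖ ≤ c * D := by
    intro D hD0 hD u hu
    have hκD : 0 ≤ κ * D := mul_nonneg hκ0 hD0
    rw [Pi.sub_apply]
    rcases hcover u hu with h | h | ⟨i, hi, h | h⟩
    · rw [hz₁4 u h, hz₂4 u h]
      refine (hgdiff D hD u h).trans (mul_le_mul_of_nonneg_right ?_ hD0)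
      have := le_mul_of_one_le_left hNqq hM
      linarith
    · have h1 := norm_sub_le_of_eq_mulVec_add_integral le_rfl h.1.le hu.2 hM0 hκD hUcont hUbd
        hint₁ hint₂ (hfdiff D hD0 hD) (hz₁1 u h) (hz₂1 u h)
      have h2 := mul_le_mul_of_nonneg_left (hgdiff D hD 0 ⟨by linarith, le_rfl⟩) hM0
      have h3 := mul_le_mul_of_nonneg_right hc₁ hD0
      linarith
    · have h1 := hGlip i hi u (z₁ u) (z₂ u)
      rw [← hz₁3 i hi u h, ← hz₂3 i hi u h] at h1
      have h2 : ‖z₁ u - z₂ u‖ ≤ 0 := by nlinarith [norm_nonneg (z₁ u - z₂ u)]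
      exact h2.trans (mul_nonneg hc0 hD0)
    · have hs0 : 0 ≤ ss i := (htt_nonneg i hi).trans (hts i hi).1
      have hsτ : ss i ≤ τ := h.1.le.trans hu.2
      have h1 := norm_sub_le_of_eq_mulVec_add_integral hs0 h.1.le hu.2 hM0 hκD hUcont hUbd
        hint₁ hint₂ (hfdiff D hD0 hD) (hz₁2 i hi u h) (hz₂2 i hi u h)
      have h2 := (hGlip i hi (ss i) (z₁ (ss i)) (z₂ (ss i))).trans
        (mul_le_mul_of_nonneg_left (hD (ss i) ⟨by linarith, hsτ⟩) hL.le)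
      have h3 := mul_le_mul_of_nonneg_left h2 hM0
      have h4 := mul_le_mul_of_nonneg_right hc₂ hD0
      linarith
  intro u hu
  exact sub_eq_zero.mp (hbdd.eq_zero_of_contracting hc0 (max_lt h4i h4ii) hcontr u hu)
end

section
/- Let s_N < p₁ < ∞ and let z : [−r,p₁) → ℝⁿ be a bounded function such that s ↦ f(s,z_s) is Lebesgue integrable on [s_N, p₁) and z(t) = U(t,s_N)·G_N(s_N, z(s_N)) + ∫_{s_N}ᵗ U(t,s)·f(s,z_s) ds for every t ∈ (s_N, p₁), where ‖f(t,φ)‖ ≤ Ψ(‖φ‖) for all t and bounded φ : [−r,0] → ℝⁿ with Ψ : [0,∞) → [0,∞) continuous and non-decreasing. Then the left limit lim_{t → p₁⁻} z(t) exists in ℝⁿ; consequently z extends continuously (from the left) to p₁. -/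
open Matrix MeasureTheory Set Filter

theorem Continuous.matrix_inv_of_isUnit_s11 {X m : Type*} [TopologicalSpace X] [Fintype m]
    [DecidableEq m] {M : X → Matrix m m ℝ} (hM : Continuous M) (hM' : ∀ x, IsUnit (M x)) :
    Continuous fun x => (M x)⁻¹ := by
  simp only [Matrix.inv_def, Ring.inverse_eq_inv']
  exact (hM.matrix_det.inv₀ fun x => ((Matrix.isUnit_iff_isUnit_det _).1 (hM' x)).ne_zero).smul
    hM.matrix_adjugate

theorem MeasureTheory.IntegrableOn.continuous_mulVec {m k : Type*} [Fintype m] [Fintype k]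
    {M : ℝ → Matrix m k ℝ} (hM : Continuous M) {g : ℝ → k → ℝ} {K : Set ℝ} (hK : IsCompact K)
    (hg : IntegrableOn g K volume) :
    IntegrableOn (fun s => M s *ᵥ g s) K volume := by
  refine Integrable.of_eval fun i => ?_
  simp only [Matrix.mulVec, dotProduct]
  refine integrable_finsetSum _ fun j _ => ?_
  exact IntegrableOn.continuousOn_mul (hM.matrix_elem i j).continuousOn (hg.eval j) hK

theorem intervalIntegral_mulVec {m k : Type*} [Fintype m] [Fintype k] (M : Matrix m k ℝ)
    {h : ℝ → k → ℝ} {a b : ℝ} (hh : IntervalIntegrable h volume a b) :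
    ∫ s in a..b, M *ᵥ h s = M *ᵥ ∫ s in a..b, h s :=
  (LinearMap.toContinuousLinearMap M.mulVecLin).intervalIntegral_comp_comm hh

/-- A bounded solution of the integral equation on `(s_N, p₁)`, with
`‖f(t,φ)‖ ≤ Ψ(‖φ‖)`, has a left limit at `p₁`; hence it extends continuously
(from the left) to `p₁`. -/
theorem solution_has_left_limit_at_endpoint
    (n : ℕ) (hn : 1 ≤ n) (r : ℝ) (hr : 0 < r)
    (sN p₁ : ℝ) (hsN : 0 ≤ sN) (hsNp₁ : sN < p₁)
    (A : ℝ → Matrix (Fin n) (Fin n) ℝ) (hA : Continuous A)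
    (Φ : ℝ → Matrix (Fin n) (Fin n) ℝ)
    (hΦderiv : ∀ t : ℝ, ∀ i j : Fin n,
      HasDerivAt (fun u => Φ u i j) ((A t * Φ t) i j) t)
    (hΦ0 : Φ 0 = 1) (hΦinv : ∀ t, IsUnit (Φ t))
    (U : ℝ → ℝ → Matrix (Fin n) (Fin n) ℝ)
    (hU : ∀ t s : ℝ, U t s = Φ t * (Φ s)⁻¹)
    (GN : ℝ → (Fin n → ℝ) → (Fin n → ℝ))
    (f : ℝ → (ℝ → (Fin n → ℝ)) → (Fin n → ℝ))
    (Ψ : ℝ → ℝ) (hΨcont : Continuous Ψ) (hΨmono : Monotone Ψ)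
    (hΨnonneg : ∀ a : ℝ, 0 ≤ Ψ a)
    (hfbd : ∀ t : ℝ, ∀ φ' : ℝ → (Fin n → ℝ), BddOn (-r) 0 φ' →
      ‖f t φ'‖ ≤ Ψ (supOn (-r) 0 φ'))
    -- the bounded solution on [−r, p₁)
    (z : ℝ → (Fin n → ℝ))
    (hzbdd : ∃ C : ℝ, ∀ u ∈ Set.Ico (-r) p₁, ‖z u‖ ≤ C)
    (hfint : IntegrableOn (fun s => f s (fun v => z (s + v))) (Set.Ico sN p₁) volume)
    (hzeq : ∀ t ∈ Set.Ioo sN p₁, z t =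
      U t sN *ᵥ GN sN (z sN)
        + ∫ s in sN..t, U t s *ᵥ f s (fun v => z (s + v))) :
    ∃ l : Fin n → ℝ, Tendsto z (nhdsWithin p₁ (Set.Iio p₁)) (nhds l) := by
  have hΦ : Continuous Φ := continuous_matrix fun i j =>
    continuous_iff_continuousAt.2 fun t => (hΦderiv t i j).continuousAt
  set h : ℝ → Fin n → ℝ := fun s => (Φ s)⁻¹ *ᵥ f s (fun v => z (s + v))
  have hint : IntegrableOn h (Set.Icc sN p₁) volume :=
    ((integrableOn_Icc_iff_integrableOn_Ico (by finiteness)).2 hfint).continuous_mulVec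
      (hΦ.matrix_inv_of_isUnit_s11 hΦinv) isCompact_Icc
  have hprim : Tendsto (fun t => ∫ s in sN..t, h s) (nhdsWithin p₁ (Set.Iio p₁))
      (nhds (∫ s in sN..p₁, h s)) := by
    have hc := intervalIntegral.continuousOn_primitive_interval
      (by rwa [Set.uIcc_of_le hsNp₁.le] : IntegrableOn h (Set.uIcc sN p₁) volume)
    rw [Set.uIcc_of_le hsNp₁.le] at hc
    have := (hc p₁ (Set.right_mem_Icc.2 hsNp₁.le)).mono Set.Ioo_subset_Icc_self
    rwa [ContinuousWithinAt, nhdsWithin_Ioo_eq_nhdsLT hsNp₁] at this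
  have hΦt : Tendsto Φ (nhdsWithin p₁ (Set.Iio p₁)) (nhds (Φ p₁)) :=
    hΦ.continuousAt.tendsto.mono_left nhdsWithin_le_nhds
  have hmul : Continuous fun q : Matrix (Fin n) (Fin n) ℝ × (Fin n → ℝ) => q.1 *ᵥ q.2 :=
    continuous_fst.matrix_mulVec continuous_snd
  refine ⟨Φ p₁ *ᵥ ((Φ sN)⁻¹ *ᵥ GN sN (z sN) + ∫ s in sN..p₁, h s), ?_⟩
  refine ((hmul.tendsto _).comp (hΦt.prodMk_nhds (hprim.const_add _))).congr' ?_
  filter_upwards [Ioo_mem_nhdsLT hsNp₁] with t ht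
  have hit : IntervalIntegrable h volume sN t :=
    (intervalIntegrable_iff_integrableOn_Icc_of_le ht.1.le).2
      (hint.mono_set (Set.Icc_subset_Icc_right ht.2.le))
  simp only [Function.comp_apply, hzeq t ht, hU, ← Matrix.mulVec_mulVec, Matrix.mulVec_add]
  rw [← intervalIntegral_mulVec _ hit]
end
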